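/- arXiv:2408.10671 — 6 statements merged into one kernel-verified Lean document; each statement's English description precedes it below -/
import Mathlib

section
/- Let n, ρ ≥ 0 be integers with r := n + ρ ≥ 1, and let S = ℂ[x_1,…,x_r]. Let f ∈ S be nonzero and squarefree, and suppose that for each l = 1,…,ρ the polynomial f is weighted homogeneous of some weighted degree β_l ∈ ℤ with respect to integer weights (w^{(l)}_1,…,w^{(l)}_r). For each l set ε^{(l)} := (w^{(l)}_1·x_1,…,w^{(l)}_r·x_r) ∈ S^r, and let ν_1,…,ν_n ∈ D_0(f) be Jacobian syzygies of f. If the determinant of the r×r matrix over S whose first n columns are ν_1,…,ν_n and whose last ρ columns are ε^{(1)},…,ε^{(ρ)} equals c·f for some nonzero constant c ∈ ℂ, then the r vectors ν_1,…,ν_n, ε^{(1)},…,ε^{(ρ)} form a basis of the S-module D(f). (This is the 'if' direction of the paper's toric Saito criterion, Theorem 4.2(i), read on the Cox ring: the columns ε^{(l)} are the Euler derivations determined by a ℤ^ρ-grading of S.) -/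
open MvPolynomial

/-- The extended logarithmic derivation module `D(f)`:
all `μ ∈ S^r` with `f ∣ Σ_i μ_i · ∂f/∂x_i`. -/
noncomputable def Dlog {r : ℕ} (f : MvPolynomial (Fin r) ℂ) :
    Submodule (MvPolynomial (Fin r) ℂ) (Fin r → MvPolynomial (Fin r) ℂ) where
  carrier := {μ | f ∣ ∑ i, μ i * pderiv i f}
  add_mem' {a b} ha hb := by
    simpa [add_mul, Finset.sum_add_distrib] using dvd_add ha hb
  zero_mem' := by simp
  smul_mem' c μ hμ := by
    simpa [smul_eq_mul, mul_assoc, Finset.mul_sum] using hμ.mul_left c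

/-- The Jacobian syzygy module `D₀(f)`: all `μ ∈ S^r` with `Σ_i μ_i · ∂f/∂x_i = 0`. -/
noncomputable def Dsyz {r : ℕ} (f : MvPolynomial (Fin r) ℂ) :
    Submodule (MvPolynomial (Fin r) ℂ) (Fin r → MvPolynomial (Fin r) ℂ) where
  carrier := {μ | ∑ i, μ i * pderiv i f = 0}
  add_mem' {a b} ha hb := by
    simp only [Set.mem_setOf_eq] at *
    simp [add_mul, Finset.sum_add_distrib, ha, hb]
  zero_mem' := by simp
  smul_mem' c μ hμ := by
    simp only [Set.mem_setOf_eq] at *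
    simp [smul_eq_mul, mul_assoc, ← Finset.mul_sum, hμ]

/-- The coefficientwise action of the Euler operator `x_i ∂/∂x_i`. -/
theorem MvPolynomial.coeff_X_mul_pderiv {σ R : Type*} [CommSemiring R] (i : σ)
    (p : MvPolynomial σ R) (m : σ →₀ ℕ) :
    coeff m (X i * pderiv i p) = m i * coeff m p := by
  classical
  induction p using MvPolynomial.induction_on' with
  | monomial u a =>
    rw [X_mul_pderiv_monomial, coeff_smul, coeff_monomial, nsmul_eq_mul]
    split_ifs with h
    · rw [h]
    · simp
  | add p q hp hq => rw [map_add, mul_add, coeff_add, hp, hq, coeff_add, mul_add]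

/-- Euler's identity for weighted homogeneous polynomials with integer weights. -/
theorem MvPolynomial.sum_weight_mul_X_mul_pderiv {σ R : Type*} [Fintype σ] [CommRing R]
    {p : MvPolynomial σ R} {w : σ → ℤ} {b : ℤ}
    (h : ∀ a ∈ p.support, ∑ i, (a i : ℤ) * w i = b) :
    ∑ i, (w i : MvPolynomial σ R) * X i * pderiv i p = (b : MvPolynomial σ R) * p := by
  ext m
  have key (k : ℤ) (q : MvPolynomial σ R) :
      coeff m ((k : MvPolynomial σ R) * q) = (k : R) * coeff m q := by
    rw [← map_intCast (C : R →+* MvPolynomial σ R), coeff_C_mul]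
  simp only [coeff_sum, mul_assoc, key, coeff_X_mul_pderiv]
  by_cases hm : coeff m p = 0
  · simp [hm]
  · rw [← h m (mem_support_iff.mpr hm)]
    push_cast
    rw [Finset.sum_mul]
    exact Finset.sum_congr rfl fun i _ => by ring

theorem MvPolynomial.degreeOf_pderiv_lt {σ R : Type*} [CommSemiring R] {i : σ}
    {p : MvPolynomial σ R} (h : pderiv i p ≠ 0) :
    degreeOf i (pderiv i p) < degreeOf i p := by
  have key : ∀ m ∈ (pderiv i p).support, m i < degreeOf i p := by
    intro m hm
    have hc : coeff (m + Finsupp.single i 1) p ≠ 0 := by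
      intro h0
      rw [mem_support_iff, coeff_pderiv, h0, zero_mul] at hm
      exact hm rfl
    have := monomial_le_degreeOf i (mem_support_iff.mpr hc)
    simp only [Finsupp.add_apply, Finsupp.single_eq_same] at this
    omega
  obtain ⟨m, hm⟩ := support_nonempty.mpr h
  rw [degreeOf_eq_sup, Finset.sup_lt_iff (lt_of_le_of_lt (Nat.zero_le _) (key m hm))]
  exact key

/-- A polynomial over a domain dividing one of its partial derivatives has that derivative zero. -/
theorem MvPolynomial.pderiv_eq_zero_of_dvd {σ R : Type*} [CommRing R] [IsDomain R] {i : σ}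
    {p : MvPolynomial σ R} (h : p ∣ pderiv i p) : pderiv i p = 0 := by
  by_contra h0
  obtain ⟨q, hq⟩ := h
  have hlt := degreeOf_pderiv_lt h0
  rw [hq] at h0 hlt
  rw [degreeOf_mul_eq (left_ne_zero_of_mul h0) (right_ne_zero_of_mul h0)] at hlt
  omega

theorem MvPolynomial.eq_C_of_forall_pderiv_eq_zero {σ R : Type*} [CommRing R] [IsDomain R]
    [CharZero R] {p : MvPolynomial σ R} (h : ∀ i, pderiv i p = 0) : p = C (coeff 0 p) := by
  classical
  ext m
  rw [coeff_C]
  split_ifs with hm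
  · rw [hm]
  · obtain ⟨i, hi⟩ := Finsupp.ne_iff.mp (Ne.symm hm)
    have := coeff_X_mul_pderiv i p m
    rw [h i, mul_zero, coeff_zero, eq_comm, mul_eq_zero, Nat.cast_eq_zero] at this
    exact this.resolve_left hi

/-- An irreducible polynomial over a field of characteristic zero does not divide all of its
partial derivatives. -/
theorem MvPolynomial.exists_not_dvd_pderiv {σ K : Type*} [Field K] [CharZero K]
    {p : MvPolynomial σ K} (hp : Irreducible p) : ∃ i, ¬ p ∣ pderiv i p := by
  by_contra! h
  have hC := eq_C_of_forall_pderiv_eq_zero fun i => pderiv_eq_zero_of_dvd (h i)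
  refine hp.not_isUnit ?_
  have h0 := hp.ne_zero
  rw [hC] at h0 ⊢
  exact (IsUnit.mk0 _ fun h => h0 (by rw [h, C_0])).map C

/-- A squarefree element divides everything that all of its prime divisors divide. -/
theorem Squarefree.dvd_of_forall_prime_dvd {α : Type*} [CommMonoidWithZero α]
    [UniqueFactorizationMonoid α] {a b : α} (ha0 : a ≠ 0) (ha : Squarefree a)
    (h : ∀ p, Prime p → p ∣ a → p ∣ b) : a ∣ b := by
  induction a using UniqueFactorizationMonoid.induction_on_prime with
  | h₁ => exact absurd rfl ha0
  | h₂ x hx => exact hx.dvd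
  | h₃ x p hx hp ih =>
    have hrel : IsRelPrime p x := (squarefree_mul_iff.mp ha).1
    exact hrel.mul_dvd (h p hp (dvd_mul_right p x))
      (ih hx (ha.squarefree_of_dvd (dvd_mul_left x p))
        fun q hq hqx => h q hq (hqx.mul_left p))

/-- Saito's lemma: the determinant of `r` logarithmic derivations of a squarefree `f` is divisible
by `f`. -/
theorem dvd_det_of_forall_col_mem_Dlog {r : ℕ} {f : MvPolynomial (Fin r) ℂ} (hf0 : f ≠ 0)
    (hsq : Squarefree f) (A : Matrix (Fin r) (Fin r) (MvPolynomial (Fin r) ℂ))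
    (hA : ∀ j, A.col j ∈ Dlog f) : f ∣ A.det := by
  have hdiv : ∀ i, f ∣ A.det * pderiv i f := by
    intro i
    have h : Matrix.vecMul (fun k => pderiv k f) (A * A.adjugate) i = A.det * pderiv i f := by
      rw [Matrix.mul_adjugate, Matrix.vecMul_smul, Matrix.vecMul_one]
      simp
    rw [← h, ← Matrix.vecMul_vecMul]
    rw [Matrix.vecMul_eq_sum, Finset.sum_apply]
    refine Finset.dvd_sum fun j _ => ?_
    rw [Pi.smul_apply, smul_eq_mul]
    refine dvd_mul_of_dvd_left ?_ _
    have hj : f ∣ ∑ k, A k j * pderiv k f := hA j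
    simpa [Matrix.vecMul, dotProduct, mul_comm] using hj
  refine hsq.dvd_of_forall_prime_dvd hf0 ?_
  rintro p hp ⟨g, rfl⟩
  obtain ⟨i, hi⟩ := exists_not_dvd_pderiv hp.irreducible
  have hpg : ¬ p ∣ g := fun ⟨k, hk⟩ =>
    hp.not_isUnit (hsq p ⟨k, by rw [hk, mul_assoc]⟩)
  have h := (dvd_mul_right p g).trans (hdiv i)
  rw [pderiv_mul, mul_add] at h
  have h' : p ∣ A.det * (pderiv i p * g) :=
    (dvd_add_left ((dvd_mul_right p _).mul_left _)).mp h
  exact (hp.dvd_or_dvd h').resolve_right fun h'' => (hp.dvd_or_dvd h'').elim hi hpg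

/-- Saito's criterion: `r` logarithmic derivations of a squarefree `f` whose determinant is a
nonzero constant multiple of `f` form a basis of `D(f)`. -/
theorem linearIndependent_and_span_eq_Dlog {r : ℕ} {f : MvPolynomial (Fin r) ℂ} (hf0 : f ≠ 0)
    (hsq : Squarefree f) (A : Matrix (Fin r) (Fin r) (MvPolynomial (Fin r) ℂ))
    (hA : ∀ j, A.col j ∈ Dlog f) {c : ℂ} (hc : c ≠ 0) (hdet : A.det = C c * f) :
    LinearIndependent (MvPolynomial (Fin r) ℂ) A.col ∧
      Submodule.span (MvPolynomial (Fin r) ℂ) (Set.range A.col) = Dlog f := by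
  have hCc : (C c : MvPolynomial (Fin r) ℂ) ≠ 0 := by simpa using hc
  refine ⟨Matrix.linearIndependent_cols_of_det_ne_zero (hdet ▸ mul_ne_zero hCc hf0),
    le_antisymm (Submodule.span_le.mpr (Set.range_subset_iff.mpr hA)) fun μ hμ => ?_⟩
  have hdvd : ∀ j, f ∣ A.cramer μ j := by
    intro j
    rw [Matrix.cramer_apply]
    refine dvd_det_of_forall_col_mem_Dlog hf0 hsq _ fun k => ?_
    by_cases hk : k = j
    · subst hk
      convert hμ using 1
      ext1 i
      simp
    · convert hA k using 1
      ext1 i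
      simp [hk]
  choose h hh using hdvd
  have hcr : A.cramer μ = f • h := funext hh
  have heq : A.mulVec h = (C c : MvPolynomial (Fin r) ℂ) • μ := by
    have := Matrix.mulVec_cramer A μ
    rw [hcr, Matrix.mulVec_smul, hdet, mul_comm, mul_smul] at this
    exact smul_right_injective _ hf0 this
  have hμ' : μ = A.mulVec ((C c⁻¹ : MvPolynomial (Fin r) ℂ) • h) := by
    rw [Matrix.mulVec_smul, heq, smul_smul, ← C_mul, inv_mul_cancel₀ hc, C_1, one_smul]
  rw [hμ', ← Matrix.range_mulVecLin]
  exact ⟨_, rfl⟩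

/-- The "if" direction of the toric Saito criterion (Theorem 4.2(i)) read on the Cox ring
`S = ℂ[x_1,…,x_r]` with `r = n + ρ`: given a nonzero squarefree `f` which is weighted
homogeneous of weighted degree `β l` for each of `ρ` integer gradings `w l`, given the
Euler derivations `ε l = (w l 1 · x_1, …, w l r · x_r)` and Jacobian syzygies
`ν_1, …, ν_n ∈ D₀(f)`, if the determinant of the `r × r` matrix whose columns are
`ν_1,…,ν_n, ε_1,…,ε_ρ` equals `c·f` for some nonzero constant `c`, then these `r` vectors
form a basis of the `S`-module `D(f)`. -/
theorem toric_saito_criterion_if (n ρ : ℕ) (hr : 1 ≤ n + ρ)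
    (f : MvPolynomial (Fin (n + ρ)) ℂ) (hf0 : f ≠ 0) (hsq : Squarefree f)
    (w : Fin ρ → Fin (n + ρ) → ℤ) (β : Fin ρ → ℤ)
    (hhom : ∀ l, ∀ a ∈ f.support, ∑ i, (a i : ℤ) * w l i = β l)
    (ε : Fin ρ → Fin (n + ρ) → MvPolynomial (Fin (n + ρ)) ℂ)
    (hε : ∀ l i, ε l i = (w l i : MvPolynomial (Fin (n + ρ)) ℂ) * X i)
    (ν : Fin n → Fin (n + ρ) → MvPolynomial (Fin (n + ρ)) ℂ)
    (hν : ∀ j, ν j ∈ Dsyz f)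
    (cols : Fin (n + ρ) → Fin (n + ρ) → MvPolynomial (Fin (n + ρ)) ℂ)
    (hcols : cols = Fin.addCases ν ε)
    (c : ℂ) (hc : c ≠ 0)
    (hdet : (Matrix.of fun i j => cols j i).det = C c * f) :
    LinearIndependent (MvPolynomial (Fin (n + ρ)) ℂ) cols ∧
      Submodule.span (MvPolynomial (Fin (n + ρ)) ℂ) (Set.range cols) = Dlog f := by
  have hmem : ∀ j, cols j ∈ Dlog f := by
    subst hcols
    refine Fin.addCases (fun j => ?_) fun l => ?_
    · have h : ∑ i, ν j i * pderiv i f = 0 := hν j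
      simpa [Dlog] using h ▸ dvd_zero f
    · beta_reduce
      rw [Fin.addCases_right]
      refine ⟨(β l : MvPolynomial (Fin (n + ρ)) ℂ), ?_⟩
      simp only [hε]
      rw [sum_weight_mul_X_mul_pderiv (hhom l), mul_comm]
  exact linearIndependent_and_span_eq_Dlog hf0 hsq (Matrix.of fun i j => cols j i) hmem hc hdet
end

section
/- Let R be a Noetherian integrally closed integral domain, and let θ : M → N be an injective R-linear map between finitely generated reflexive R-modules. If for every prime ideal p of R of height at most 1 the induced map of localizations M_p → N_p is surjective, then θ is an isomorphism. (This is the affine-local form of the paper's Lemma 4.4 on monomorphisms of reflexive sheaves on a normal integral scheme whose cokernel is supported in codimension at least two.) -/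
/-- An associated prime of a principal ideal generated by a nonzero element of a Noetherian
integrally closed domain has height at most one. -/
theorem Ideal.height_le_one_of_isAssociatedPrime_quotient_span_singleton
    {R : Type*} [CommRing R] [IsDomain R] [IsNoetherianRing R] [IsIntegrallyClosed R]
    {a : R} (ha : a ≠ 0) {p : Ideal R} (hp : IsAssociatedPrime p (R ⧸ Ideal.span {a})) :
    p.height ≤ 1 := by
  obtain ⟨hprime, y, hy⟩ := isAssociatedPrime_iff.mp hp
  obtain ⟨b, rfl⟩ := Ideal.Quotient.mk_surjective y
  have hmem (r : R) : r ∈ p ↔ ∃ c, r * b = a * c := by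
    rw [hy, Submodule.mem_colon_singleton, Submodule.mem_bot, ← Ideal.Quotient.mk_eq_mk,
      ← Submodule.Quotient.mk_smul, Submodule.Quotient.mk_eq_zero, Ideal.mem_span_singleton]
    rfl
  have hap : a ∈ p := (hmem a).2 ⟨b, rfl⟩
  have ha' : algebraMap R (FractionRing R) a ≠ 0 := by simpa using ha
  -- Otherwise `b / a` is integral over `R`, hence lies in `R`, and `1 ∈ p`.
  obtain ⟨t, ht, u, hu, htu⟩ : ∃ t ∈ p, ∃ u ∉ p, t * b = a * u := by
    by_contra! H
    let x : FractionRing R := algebraMap R _ b / algebraMap R _ a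
    have hx : IsIntegral R x := by
      refine isIntegral_of_smul_mem_submodule
        (Submodule.map (Algebra.linearMap R (FractionRing R)) p) ?_
        ((IsNoetherian.noetherian p).map _) x ?_
      · exact (Submodule.ne_bot_iff _).2 ⟨_, ⟨a, hap, rfl⟩, ha'⟩
      · rintro _ ⟨r, hr, rfl⟩
        obtain ⟨c, hc⟩ := (hmem r).1 hr
        refine ⟨c, by_contra fun hcp ↦ H r hr c hcp hc, ?_⟩
        have hc' := congrArg (algebraMap R (FractionRing R)) hc
        simp only [map_mul] at hc'
        simp only [Algebra.linearMap_apply, smul_eq_mul, x]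
        field_simp
        linear_combination -hc'
    obtain ⟨z, hz⟩ := IsIntegrallyClosed.algebraMap_eq_of_integral hx
    refine hprime.ne_top ((Ideal.eq_top_iff_one p).2 ((hmem 1).2 ⟨z, ?_⟩))
    apply IsFractionRing.injective R (FractionRing R)
    rw [one_mul, map_mul, hz, mul_div_cancel₀ _ ha']
  refine Ideal.height_le_one_of_isPrincipal_of_mem_minimalPrimes (Ideal.span {t}) p
    ⟨⟨hprime, by simpa [Ideal.span_le] using ht⟩, fun q hq hqp r hr ↦ ?_⟩
  obtain ⟨c, hc⟩ := (hmem r).1 hr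
  have htq : t ∈ q := hq.2 (Ideal.mem_span_singleton_self t)
  have hur : u * r = c * t := mul_left_cancel₀ ha (by linear_combination t * hc - r * htu)
  exact (hq.1.mem_or_mem (hur ▸ q.mul_mem_left c htq)).resolve_left fun h ↦ hu (hqp h)

/-- In a Noetherian integrally closed domain, if an ideal contained in no prime of height at most
one multiplies `b` into a nonzero principal ideal, then `b` lies in that principal ideal. -/
theorem Ideal.dvd_of_forall_dvd_mul_of_forall_height_le_one
    {R : Type*} [CommRing R] [IsDomain R] [IsNoetherianRing R] [IsIntegrallyClosed R]
    {I : Ideal R} (hI : ∀ p : Ideal R, p.IsPrime → p.height ≤ 1 → ¬ I ≤ p)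
    {a b : R} (ha : a ≠ 0) (h : ∀ r ∈ I, a ∣ r * b) : a ∣ b := by
  by_contra hab
  have hb : Ideal.Quotient.mk (Ideal.span {a}) b ≠ 0 := by
    rwa [Ne, Ideal.Quotient.eq_zero_iff_mem, Ideal.mem_span_singleton]
  obtain ⟨p, hp, hle⟩ := exists_le_isAssociatedPrime_of_isNoetherianRing R _ hb
  refine hI p hp.isPrime
    (Ideal.height_le_one_of_isAssociatedPrime_quotient_span_singleton ha hp) fun r hr ↦ hle ?_
  rw [Submodule.mem_colon_singleton, Submodule.mem_bot, ← Ideal.Quotient.mk_eq_mk,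
    ← Submodule.Quotient.mk_smul, Submodule.Quotient.mk_eq_zero, Ideal.mem_span_singleton]
  exact h r hr

/-- If a linear map to a finite module is surjective after localizing at `p`, then the annihilator
of its cokernel is not contained in `p`. -/
theorem LinearMap.not_annihilator_le_of_surjective_localizedModule_map
    {R M N : Type*} [CommRing R] [AddCommGroup M] [AddCommGroup N] [Module R M] [Module R N]
    [Module.Finite R N] (θ : M →ₗ[R] N) (p : Ideal R) [hp : p.IsPrime]
    (h : Function.Surjective (LocalizedModule.map p.primeCompl θ)) :
    ¬ Module.annihilator R (N ⧸ LinearMap.range θ) ≤ p := by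
  have key : (⟨p, hp⟩ : PrimeSpectrum R) ∉ Module.support R (N ⧸ LinearMap.range θ) := by
    rw [Module.notMem_support_iff']
    intro x
    obtain ⟨n, rfl⟩ := Submodule.Quotient.mk_surjective _ x
    obtain ⟨y, hy⟩ := h (LocalizedModule.mk n 1)
    induction y using LocalizedModule.induction_on with
    | h m s =>
      rw [LocalizedModule.map_mk, LocalizedModule.mk_eq] at hy
      obtain ⟨u, hu⟩ := hy
      refine ⟨(u * s : p.primeCompl), (u * s).2, ?_⟩
      rw [← Submodule.Quotient.mk_smul, Submodule.Quotient.mk_eq_zero]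
      refine ⟨(u : R) • m, ?_⟩
      simpa [Submonoid.smul_def, mul_smul] using hu
  rwa [Module.mem_support_iff_of_finite] at key

/-- An injective linear map of modules over a Noetherian integrally closed domain, the annihilator
of whose cokernel lies in no prime of height at most one, has bijective transpose. -/
theorem LinearMap.bijective_dualMap_of_forall_height_le_one
    {R M N : Type*} [CommRing R] [IsDomain R] [IsNoetherianRing R] [IsIntegrallyClosed R]
    [AddCommGroup M] [AddCommGroup N] [Module R M] [Module R N]
    {θ : M →ₗ[R] N} (hθ : Function.Injective θ)
    (h : ∀ p : Ideal R, p.IsPrime → p.height ≤ 1 →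
      ¬ Module.annihilator R (N ⧸ LinearMap.range θ) ≤ p) :
    Function.Bijective θ.dualMap := by
  have hann {r : R} (hr : r ∈ Module.annihilator R (N ⧸ LinearMap.range θ)) (n : N) :
      r • n ∈ LinearMap.range θ := by
    rw [← Submodule.Quotient.mk_eq_zero, Submodule.Quotient.mk_smul]
    exact Module.mem_annihilator.1 hr _
  obtain ⟨a, haI, ha⟩ := Set.not_subset.1 (h ⊥ Ideal.isPrime_bot (by simp))
  replace ha : a ≠ 0 := ha
  constructor
  · rw [injective_iff_map_eq_zero]
    intro g hg
    ext n
    obtain ⟨m, hm⟩ := hann haI n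
    have hgm : g (θ m) = 0 := LinearMap.congr_fun hg m
    rw [hm, map_smul, smul_eq_mul] at hgm
    exact (mul_eq_zero.1 hgm).resolve_left ha
  · intro f
    choose σ hσ using hann haI
    have hdvd (n : N) : a ∣ f (σ n) := by
      refine Ideal.dvd_of_forall_dvd_mul_of_forall_height_le_one h ha fun r hr ↦ ?_
      obtain ⟨m, hm⟩ := hann hr n
      have hrm : r • σ n = a • m := hθ (by rw [map_smul, map_smul, hσ, hm, smul_comm])
      refine ⟨f m, ?_⟩
      rw [← smul_eq_mul, ← map_smul, hrm, map_smul, smul_eq_mul]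
    choose g hg using hdvd
    refine ⟨{ toFun := g, map_add' := fun x y ↦ ?_, map_smul' := fun r x ↦ ?_ }, ?_⟩
    · have hadd : σ (x + y) = σ x + σ y := hθ (by simp [hσ])
      refine mul_left_cancel₀ ha ?_
      rw [← hg, hadd, map_add, hg, hg, mul_add]
    · have hsmul : σ (r • x) = r • σ x := hθ (by rw [hσ, map_smul, hσ, smul_comm])
      refine mul_left_cancel₀ ha ?_
      rw [← hg, hsmul, map_smul, hg, RingHom.id_apply, smul_eq_mul, smul_eq_mul,
        mul_left_comm]
    · ext m
      refine mul_left_cancel₀ ha ?_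
      have hm : σ (θ m) = a • m := hθ (by rw [hσ, map_smul])
      rw [LinearMap.dualMap_apply, LinearMap.coe_mk, AddHom.coe_mk, ← hg, hm, map_smul,
        smul_eq_mul]

/-- A linear map between reflexive modules is bijective if its transpose is. -/
theorem LinearMap.bijective_of_bijective_dualMap
    {R M N : Type*} [CommRing R] [AddCommGroup M] [AddCommGroup N] [Module R M] [Module R N]
    [Module.IsReflexive R M] [Module.IsReflexive R N] {θ : M →ₗ[R] N}
    (h : Function.Bijective θ.dualMap) : Function.Bijective θ := by
  have hθ : Function.Bijective θ.dualMap.dualMap :=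
    (LinearEquiv.ofBijective θ.dualMap h).dualMap.bijective
  have hcomp : Module.Dual.eval R N ∘ θ = θ.dualMap.dualMap ∘ Module.Dual.eval R M := rfl
  rw [← Function.Bijective.of_comp_iff' (Module.bijective_dual_eval R N), hcomp]
  exact hθ.comp (Module.bijective_dual_eval R M)

/-- Affine-local form of Lemma 4.4 of the paper: a monomorphism of finitely generated
reflexive modules over a Noetherian integrally closed domain which is surjective after
localization at every prime of height at most one is an isomorphism. -/
theorem reflexive_mono_iso_of_codim_two
    (R : Type*) [CommRing R] [IsDomain R] [IsNoetherianRing R] [IsIntegrallyClosed R]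
    (M N : Type*) [AddCommGroup M] [AddCommGroup N] [Module R M] [Module R N]
    [Module.Finite R M] [Module.Finite R N]
    [Module.IsReflexive R M] [Module.IsReflexive R N]
    (θ : M →ₗ[R] N) (hθ : Function.Injective θ)
    (hloc : ∀ (p : Ideal R) (hp : p.IsPrime),
      Order.height (⟨p, hp⟩ : PrimeSpectrum R) ≤ 1 →
      Function.Surjective (LocalizedModule.map p.primeCompl θ)) :
    Function.Bijective θ := by
  refine LinearMap.bijective_of_bijective_dualMap
    (LinearMap.bijective_dualMap_of_forall_height_le_one hθ fun p hp hht ↦ ?_)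
  refine θ.not_annihilator_le_of_surjective_localizedModule_map p (hloc p hp ?_)
  rwa [← PrimeSpectrum.height_eq_orderHeight]
end

section
/- Let r ≥ 1, let S = ℂ[x_1,…,x_r], and let {1,…,r} be partitioned into pairwise disjoint nonempty blocks L_1,…,L_s. Define the toric braid polynomial b := Π_{k=1}^s Π_{i<j, i,j ∈ L_k} (x_i − x_j) ∈ S. For each k ∈ {1,…,s} and each m with 0 ≤ m ≤ |L_k| − 1, let θ_{k,m} ∈ S^r be the vector whose i-th coordinate is x_i^m if i ∈ L_k and 0 otherwise. Then the r vectors θ_{k,m} form a basis of the S-module D(b); in particular D(b) is a free S-module of rank r. (This is the module-level content of Proposition 4.7 of the paper: the toric braid arrangement is free.) -/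
open MvPolynomial

/-- The linear form `X i - X j` divides exactly the polynomials that vanish upon identifying
the variables `X i` and `X j`. -/
theorem X_sub_X_dvd_iff {σ R : Type*} [CommRing R] [DecidableEq σ] (i j : σ)
    (f : MvPolynomial σ R) :
    X i - X j ∣ f ↔ rename (Function.update id i j) f = 0 := by
  constructor
  · rintro ⟨g, rfl⟩
    by_cases h : j = i <;> simp [h]
  · intro h
    let I : Ideal (MvPolynomial σ R) := Ideal.span {X i - X j}
    have key : (Ideal.Quotient.mkₐ R I).comp (rename (Function.update id i j)) =
        Ideal.Quotient.mkₐ R I := by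
      ext k
      by_cases hk : k = i
      · subst hk
        simp only [AlgHom.comp_apply, rename_X, Function.update_self, Ideal.Quotient.mkₐ_eq_mk]
        exact (Ideal.Quotient.eq.2 (Ideal.mem_span_singleton_self _)).symm
      · simp [Function.update_of_ne hk]
    have hf := DFunLike.congr_fun key f
    rw [AlgHom.comp_apply, h, map_zero, Ideal.Quotient.mkₐ_eq_mk, eq_comm,
      Ideal.Quotient.eq_zero_iff_mem, Ideal.mem_span_singleton] at hf
    exact hf

theorem prime_X_sub_X {σ R : Type*} [CommRing R] [IsDomain R] {i j : σ} (hij : i ≠ j) :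
    Prime (X i - X j : MvPolynomial σ R) := by
  classical
  refine ⟨sub_ne_zero.2 fun h => hij (X_injective h), fun h => ?_, fun f g h => ?_⟩
  · have := (X_sub_X_dvd_iff i j (1 : MvPolynomial σ R)).1 h.dvd
    simp at this
  · simpa [X_sub_X_dvd_iff] using h

theorem isRelPrime_X_sub_X {σ R : Type*} [CommRing R] [IsDomain R] {i j k l : σ}
    (hij : i ≠ j) (hkl : k ≠ l) (h₁ : ¬(i = k ∧ j = l)) (h₂ : ¬(i = l ∧ j = k)) :
    IsRelPrime (X i - X j : MvPolynomial σ R) (X k - X l) := by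
  classical
  rw [(prime_X_sub_X hij).irreducible.isRelPrime_iff_not_dvd, X_sub_X_dvd_iff, map_sub,
    rename_X, rename_X, sub_eq_zero]
  intro h
  have := X_injective h
  simp only [Function.update_apply, id] at this
  grind

/-- A derivation is logarithmic along a product of pairwise coprime factors if and only if it is
logarithmic along each of them. -/
theorem prod_dvd_derivation_iff {ι R A : Type*} [CommRing R] [CommRing A] [Algebra R A]
    [DecompositionMonoid A] (D : Derivation R A A) (t : Finset ι) (l : ι → A)
    (hl : (t : Set ι).Pairwise (Function.onFun IsRelPrime l)) :
    ∏ p ∈ t, l p ∣ D (∏ p ∈ t, l p) ↔ ∀ p ∈ t, l p ∣ D (l p) := by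
  classical
  constructor
  · intro h p hp
    have h1 := (Finset.dvd_prod_of_mem l hp).trans h
    rw [← Finset.mul_prod_erase t l hp, D.leibniz, smul_eq_mul, smul_eq_mul,
      dvd_add_right (dvd_mul_right _ _)] at h1
    refine IsRelPrime.dvd_of_dvd_mul_left (IsRelPrime.prod_right fun q hq => ?_) h1
    rw [Finset.mem_erase] at hq
    exact hl hp hq.2 hq.1.symm
  · intro h
    refine Finset.prod_dvd_of_isRelPrime hl fun p hp => ?_
    rw [← Finset.mul_prod_erase t l hp, D.leibniz, smul_eq_mul, smul_eq_mul]
    exact dvd_add (dvd_mul_right _ _) ((h p hp).mul_left _)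

/-- Newton interpolation: values congruent modulo the differences of the nodes are interpolated
without denominators as soon as these differences are pairwise coprime. -/
theorem exists_interpolating_polynomial {ι A : Type*} [CommRing A] [DecompositionMonoid A]
    (t : Finset ι) (v y : ι → A)
    (hv : ∀ a ∈ t, ∀ i ∈ t, ∀ j ∈ t, a ≠ i → a ≠ j → i ≠ j → IsRelPrime (v a - v i) (v a - v j))
    (hy : ∀ i ∈ t, ∀ j ∈ t, i ≠ j → v i - v j ∣ y i - y j) :
    ∃ p : Polynomial A, p.degree < t.card ∧ ∀ i ∈ t, p.eval (v i) = y i := by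
  classical
  induction t using Finset.induction_on with
  | empty => exact ⟨0, by simp⟩
  | insert a t ha ih =>
    obtain ⟨p, hp, hpy⟩ := ih
      (fun a ha i hi j hj => hv a (Finset.mem_insert_of_mem ha) i (Finset.mem_insert_of_mem hi) j
        (Finset.mem_insert_of_mem hj))
      (fun i hi j hj => hy i (Finset.mem_insert_of_mem hi) j (Finset.mem_insert_of_mem hj))
    have hne : ∀ i ∈ t, a ≠ i := fun i hi h => ha (h ▸ hi)
    have hdvd : ∏ i ∈ t, (v a - v i) ∣ y a - p.eval (v a) := by
      refine Finset.prod_dvd_of_isRelPrime (fun i hi j hj hij => ?_) fun i hi => ?_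
      · exact hv a (Finset.mem_insert_self a t) i (Finset.mem_insert_of_mem hi) j
          (Finset.mem_insert_of_mem hj) (hne i hi) (hne j hj) hij
      · have h1 := hy a (Finset.mem_insert_self a t) i (Finset.mem_insert_of_mem hi) (hne i hi)
        have h2 := p.sub_dvd_eval_sub (v a) (v i)
        rw [hpy i hi] at h2
        simpa using dvd_sub h1 h2
    obtain ⟨c, hc⟩ := hdvd
    refine ⟨p + Polynomial.C c * ∏ i ∈ t, (Polynomial.X - Polynomial.C (v i)), ?_, ?_⟩
    · rw [Finset.card_insert_of_notMem ha]
      refine (Polynomial.degree_add_le _ _).trans_lt (max_lt (hp.trans (by norm_cast; simp)) ?_)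
      nontriviality A
      refine ((Polynomial.degree_mul_le _ _).trans
        (add_le_add_left Polynomial.degree_C_le _)).trans_lt ?_
      rw [Polynomial.degree_prod_of_monic _ _ fun i _ => Polynomial.monic_X_sub_C _]
      simp only [Polynomial.degree_X_sub_C, Finset.sum_const, nsmul_eq_mul, mul_one]
      norm_cast
      omega
    · intro i hi
      rw [Polynomial.eval_add, Polynomial.eval_mul, Polynomial.eval_prod, Polynomial.eval_C]
      simp only [Polynomial.eval_sub, Polynomial.eval_X, Polynomial.eval_C]
      rcases Finset.mem_insert.1 hi with rfl | hi
      · rw [mul_comm, ← hc, add_sub_cancel]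
      · rw [Finset.prod_eq_zero hi (sub_self _), mul_zero, add_zero, hpy i hi]

/-- Logarithmic vector fields of a toric braid polynomial are exactly those whose coordinates in
a common block are congruent modulo the corresponding differences of variables. -/
theorem mem_Dlog_toric_braid_iff {r s : ℕ} {L : Fin s → Finset (Fin r)}
    (hdisj : ∀ k l, k ≠ l → Disjoint (L k) (L l)) (μ : Fin r → MvPolynomial (Fin r) ℂ) :
    μ ∈ Dlog (∏ k, ∏ i ∈ L k, ∏ j ∈ (L k).filter (fun j => i < j), (X i - X j)) ↔
      ∀ k, ∀ i ∈ L k, ∀ j ∈ L k, X i - X j ∣ μ i - μ j := by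
  let D : Derivation ℂ (MvPolynomial (Fin r) ℂ) (MvPolynomial (Fin r) ℂ) := mkDerivation ℂ μ
  let t : Finset (Σ _ : Fin s, Σ _ : Fin r, Fin r) :=
    Finset.univ.sigma fun k => (L k).sigma fun i => (L k).filter (fun j => i < j)
  have hmem : ∀ f, μ ∈ Dlog f ↔ f ∣ D f := fun f => by
    change f ∣ ∑ i, μ i * pderiv i f ↔ f ∣ D f
    have hsum : ∀ g, (∑ i, μ i • pderiv i : Derivation ℂ _ _) g = ∑ i, μ i * pderiv i g :=
      fun g => (congrFun (map_sum (Derivation.coeFnAddMonoidHom (R := ℂ))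
        (fun i => μ i • pderiv i) Finset.univ) g).trans (Finset.sum_apply _ _ _)
    have hD : D = ∑ i, μ i • pderiv i := derivation_ext fun j => by
      simp [hsum, D, mkDerivation_X, pderiv_X, Pi.single_apply]
    rw [hD, hsum]
  have hprod : (∏ k, ∏ i ∈ L k, ∏ j ∈ (L k).filter (fun j => i < j), (X i - X j)) =
      ∏ p ∈ t, (X p.2.1 - X p.2.2 : MvPolynomial (Fin r) ℂ) := by
    simp only [t, Finset.prod_sigma]
  rw [hmem, hprod, prod_dvd_derivation_iff D]
  · simp only [D, t, map_sub, mkDerivation_X, Finset.mem_sigma, Finset.mem_univ, true_and,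
      Finset.mem_filter, Sigma.forall]
    constructor
    · intro h k i hi j hj
      rcases lt_trichotomy i j with hij | rfl | hij
      · exact h k i j ⟨hi, hj, hij⟩
      · simp
      · rw [← neg_dvd, ← dvd_neg, neg_sub, neg_sub]
        exact h k j i ⟨hj, hi, hij⟩
    · exact fun h k i j hij => h k i hij.1 j hij.2.1
  · rintro ⟨k, i, j⟩ h₁ ⟨k', i', j'⟩ h₂ hne
    simp only [t, Finset.coe_sigma, Set.mem_sigma_iff, Finset.mem_coe, Finset.mem_univ,
      Finset.mem_filter, true_and] at h₁ h₂
    refine isRelPrime_X_sub_X h₁.2.2.ne h₂.2.2.ne ?_ ?_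
    · rintro ⟨rfl, rfl⟩
      have hk : k = k' := by
        by_contra hk
        exact Finset.disjoint_left.1 (hdisj k k' hk) h₁.1 h₂.1
      subst hk
      exact hne rfl
    · rintro ⟨rfl, rfl⟩
      exact lt_asymm h₁.2.2 h₂.2.2

/-- Module-level content of Proposition 4.7: the toric braid arrangement is free.
For a partition of `{1,…,r}` into nonempty blocks `L_1,…,L_s` and the toric braid
polynomial `b = Π_k Π_{i<j ∈ L_k} (x_i − x_j)`, the `r` vectors `θ_{k,m}`
(`0 ≤ m ≤ |L_k| − 1`) whose `i`-th coordinate is `x_i^m` for `i ∈ L_k` and `0`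
otherwise form a basis of `D(b)`; in particular `D(b)` is free of rank `r`. -/
theorem toric_braid_free (r s : ℕ) (hr : 1 ≤ r)
    (L : Fin s → Finset (Fin r))
    (hne : ∀ k, (L k).Nonempty)
    (hdisj : ∀ k l, k ≠ l → Disjoint (L k) (L l))
    (hcover : ∀ i : Fin r, ∃ k, i ∈ L k)
    (b : MvPolynomial (Fin r) ℂ)
    (hb : b = ∏ k, ∏ i ∈ L k, ∏ j ∈ (L k).filter (fun j => i < j), (X i - X j))
    (θ : (Σ k : Fin s, Fin (L k).card) → Fin r → MvPolynomial (Fin r) ℂ)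
    (hθ : ∀ (k : Fin s) (m : Fin (L k).card) (i : Fin r),
      θ ⟨k, m⟩ i = if i ∈ L k then X i ^ (m : ℕ) else 0) :
    LinearIndependent (MvPolynomial (Fin r) ℂ) θ ∧
      Submodule.span (MvPolynomial (Fin r) ℂ) (Set.range θ) = Dlog b := by
  subst hb
  have huniq : ∀ k l i, i ∈ L k → i ∈ L l → l = k := fun k l i hk hl => by
    by_contra h
    exact Finset.disjoint_left.1 (hdisj l k h) hl hk
  have hsum : ∀ (c : (Σ k : Fin s, Fin (L k).card) → MvPolynomial (Fin r) ℂ) (k i), i ∈ L k →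
      (∑ p, c p • θ p) i = ∑ m : Fin (L k).card, c ⟨k, m⟩ * X i ^ (m : ℕ) := by
    intro c k i hi
    simp only [Finset.sum_apply, Pi.smul_apply, smul_eq_mul, Fintype.sum_sigma, hθ]
    rw [Finset.sum_eq_single k]
    · simp [hi]
    · intro l _ hl
      have hil : i ∉ L l := fun h => hl (huniq k l i hi h)
      simp [hil]
    · simp
  refine ⟨Fintype.linearIndependent_iff.2 ?_, le_antisymm (Submodule.span_le.2 ?_) fun μ hμ => ?_⟩
  · rintro c hc ⟨k, m⟩
    have hzero : ∑ m : Fin (L k).card, Polynomial.C (c ⟨k, m⟩) * Polynomial.X ^ (m : ℕ) = 0 := by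
      refine Polynomial.eq_zero_of_degree_lt_of_eval_index_eq_zero (L k)
        (v := X) X_injective.injOn ?_ fun i hi => ?_
      · exact Polynomial.degree_sum_fin_lt fun m => c ⟨k, m⟩
      · simp only [Polynomial.eval_finsetSum, Polynomial.eval_mul, Polynomial.eval_C,
          Polynomial.eval_pow, Polynomial.eval_X, ← hsum c k i hi, hc, Pi.zero_apply]
    have := congrArg (fun p => p.coeff m) hzero
    simpa [Polynomial.finsetSum_coeff, Polynomial.coeff_X_pow, Fin.val_inj] using this
  · rintro _ ⟨⟨l, m⟩, rfl⟩
    refine (mem_Dlog_toric_braid_iff hdisj _).2 fun k i hi j hj => ?_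
    rw [hθ, hθ]
    by_cases h : l = k
    · subst h
      simpa [hi, hj] using sub_dvd_pow_sub_pow _ _ _
    · have hil : i ∉ L l := fun h' => h (huniq k l i hi h')
      have hjl : j ∉ L l := fun h' => h (huniq k l j hj h')
      simp [hil, hjl]
  · rw [mem_Dlog_toric_braid_iff hdisj] at hμ
    choose p hdeg hp using fun k => exists_interpolating_polynomial (L k) X μ
      (fun a _ i _ j _ hai haj hij => isRelPrime_X_sub_X hai haj (by grind) (by grind))
      (fun i hi j hj _ => hμ k i hi j hj)
    have hμ_eq : μ = ∑ q : (Σ k : Fin s, Fin (L k).card), (p q.1).coeff q.2 • θ q := by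
      ext1 i
      obtain ⟨k, hi⟩ := hcover i
      have hnat : (p k).natDegree < (L k).card := by
        by_cases h : p k = 0
        · simpa [h] using (hne k).card_pos
        · exact (Polynomial.natDegree_lt_iff_degree_lt h).2 (hdeg k)
      rw [hsum _ k i hi, ← hp k i hi, Polynomial.eval_eq_sum_range' hnat, Finset.sum_range]
    rw [hμ_eq]
    exact Submodule.sum_mem _ fun q _ =>
      Submodule.smul_mem _ _ (Submodule.subset_span (Set.mem_range_self q))
end

section
/- Let S be an integral domain that is a unique factorization domain and a ℚ-algebra. Let k ≥ 1 and 1 ≤ q ≤ k − 1, let f_1,…,f_k ∈ S be nonzero elements that are pairwise coprime (for i ≠ j, every common divisor of f_i and f_j is a unit), and let A be a k×q matrix with integer entries. For a strictly increasing map t : {1,…,q} → {1,…,k}, let A_t denote the q×q submatrix of A with rows t(1),…,t(q). Assume that for every j ∈ {1,…,k} there exists a strictly increasing t whose image does not contain j and such that det(A_t) ≠ 0. Then every g ∈ S that divides (det A_t)·f_{t(1)}⋯f_{t(q)} (with det A_t regarded in S via the canonical map ℤ → S) for all strictly increasing t : {1,…,q} → {1,…,k} is a unit of S. (This is the key intermediate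 claim in the proof of Theorem 5.4 of the paper: under the Cayley–Bacharach condition on the degree vector, the maximal minors of the matrix diag(f)·A have no common factor, so the cokernel of the induced map is torsion-free.) -/
/-- The image of a nonzero integer in a `ℚ`-algebra is a unit. -/
theorem isUnit_intCast_of_ne_zero (S : Type*) [CommRing S] [Algebra ℚ S] {n : ℤ} (hn : n ≠ 0) :
    IsUnit (n : S) := by
  simpa using (IsUnit.mk0 (n : ℚ) (Int.cast_ne_zero.mpr hn)).map (algebraMap ℚ S)

/-- Key intermediate claim in the proof of Theorem 5.4: let `S` be a UFD which is a
`ℚ`-algebra, `f_1,…,f_k` nonzero pairwise coprime elements, and `A` a `k×q` integer matrix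
(`1 ≤ q ≤ k−1`) such that for each `j` some maximal minor `A_t` avoiding row `j` has
nonzero determinant (the Cayley–Bacharach condition). Then any common divisor `g` of all
the products `det(A_t)·f_{t(1)}⋯f_{t(q)}`, over strictly increasing `t : Fin q → Fin k`,
is a unit: the maximal minors of `diag(f)·A` have no common factor. -/
theorem minors_no_common_factor
    (S : Type*) [CommRing S] [IsDomain S] [UniqueFactorizationMonoid S] [Algebra ℚ S]
    (k q : ℕ) (hk : 1 ≤ k) (hq1 : 1 ≤ q) (hqk : q ≤ k - 1)
    (f : Fin k → S) (hf0 : ∀ i, f i ≠ 0)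
    (hcop : ∀ i j, i ≠ j → ∀ d : S, d ∣ f i → d ∣ f j → IsUnit d)
    (A : Matrix (Fin k) (Fin q) ℤ)
    (hCB : ∀ j : Fin k, ∃ t : Fin q → Fin k, StrictMono t ∧ j ∉ Set.range t ∧
      (A.submatrix t id).det ≠ 0)
    (g : S)
    (hg : ∀ t : Fin q → Fin k, StrictMono t →
      g ∣ (((A.submatrix t id).det : ℤ) : S) * ∏ a, f (t a)) :
    IsUnit g := by
  have hdvd : ∀ t : Fin q → Fin k, StrictMono t → (A.submatrix t id).det ≠ 0 →
      g ∣ ∏ a, f (t a) := fun t ht hdet =>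
    (isUnit_intCast_of_ne_zero S hdet).dvd_mul_left.mp (hg t ht)
  obtain ⟨t, ht, -, hdet⟩ := hCB ⟨0, hk⟩
  have hg0 : g ≠ 0 :=
    ne_zero_of_dvd_ne_zero (Finset.prod_ne_zero_iff.mpr fun a _ => hf0 (t a)) (hdvd t ht hdet)
  by_contra hgu
  obtain ⟨p, hp, hpg⟩ := WfDvdMonoid.exists_irreducible_factor hgu hg0
  obtain ⟨a, -, ha⟩ := hp.prime.exists_mem_finset_dvd (hpg.trans (hdvd t ht hdet))
  obtain ⟨u, hu, hau, hudet⟩ := hCB (t a)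
  obtain ⟨b, -, hb⟩ := hp.prime.exists_mem_finset_dvd (hpg.trans (hdvd u hu hudet))
  exact hp.not_isUnit (hcop (t a) (u b) (fun h => hau ⟨b, h.symm⟩) p ha hb)
end

section
/- Let R be a commutative ring, let s ≥ 1, and let x_1,…,x_s, a_1,…,a_s ∈ R. Let M be the s×s matrix over R defined by: for 1 ≤ j ≤ s−1, column j has entry −x_j in row j, entry x_{j+1} in row j+1, and 0 elsewhere; and column s has entry a_i·x_i in row i for each 1 ≤ i ≤ s. Then det(M) = (−1)^{s−1}·(a_1 + a_2 + ⋯ + a_s)·x_1·x_2⋯x_s. (This is the determinant computation at the heart of the proof of Proposition 4.9 of the paper, where a_i = φ([D_i]) are the values of a homomorphism φ : Cl(X) → ℤ on the classes of the torus-invariant divisors.) -/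
open Matrix in
/-- The determinant of the matrix whose first `n` columns are the differences `e_{j+1} - e_j` of
consecutive standard basis vectors and whose last column is `a`. -/
theorem Matrix.det_snoc_single_succ_sub_castSucc {R : Type*} [CommRing R] {n : ℕ}
    (a : Fin (n + 1) → R) :
    (of fun i : Fin (n + 1) => (Fin.snoc (α := fun _ => R)
      (fun j : Fin n => (if i = j.succ then (1 : R) else 0) - if i = j.castSucc then 1 else 0)
      (a i) : Fin (n + 1) → R)).det = (-1) ^ n * ∑ i, a i := by
  set N : Matrix (Fin (n + 1)) (Fin (n + 1)) R := of fun i => (Fin.snoc (α := fun _ => R)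
      (fun j : Fin n => (if i = j.succ then (1 : R) else 0) - if i = j.castSucc then 1 else 0)
      (a i) : Fin (n + 1) → R) with hN
  let L : Matrix (Fin (n + 1)) (Fin (n + 1)) R := of fun i k => if k ≤ i then 1 else 0
  have hL : L.det = 1 := by
    rw [det_of_isLowerTriangular L fun i j hij => if_neg (not_le.2 hij)]
    simp [L]
  have hcast (i : Fin (n + 1)) (j : Fin n) :
      (L * N) i j.castSucc = if i = j.castSucc then -1 else 0 := by
    simp only [mul_apply, L, hN, of_apply, Fin.snoc_castSucc, mul_sub, mul_ite, mul_one, mul_zero,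
      Finset.sum_sub_distrib, Finset.sum_ite_eq', Finset.mem_univ, if_true]
    simp only [Fin.le_def, Fin.ext_iff, Fin.val_succ, Fin.val_castSucc]
    split_ifs <;> first | omega | simp
  have hlast : (L * N) (Fin.last n) (Fin.last n) = ∑ i, a i := by
    simp [mul_apply, L, hN, Fin.le_last]
  have hLN : (L * N).IsUpperTriangular := by
    intro i j hij
    induction j using Fin.lastCases with
    | last => exact absurd hij (not_lt.2 (Fin.le_last i))
    | cast j => exact (hcast i j).trans (if_neg (ne_of_gt hij))
  have hdet : N.det = (L * N).det := by rw [det_mul, hL, one_mul]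
  rw [hdet, det_of_isUpperTriangular hLN, Fin.prod_univ_castSucc, hlast]
  simp [hcast]

/-- The determinant computation at the heart of the proof of Proposition 4.9 of the paper:
the `s × s` matrix whose `j`-th column (for `1 ≤ j ≤ s−1`) has `−x_j` in row `j`,
`x_{j+1}` in row `j+1` and `0` elsewhere, and whose last column has `a_i·x_i` in row `i`,
has determinant `(−1)^{s−1}·(a_1 + ⋯ + a_s)·x_1⋯x_s`. (Indices are `0`-based here.) -/
theorem euler_column_det (R : Type*) [CommRing R] (s : ℕ) (hs : 1 ≤ s)
    (x a : Fin s → R) (M : Matrix (Fin s) (Fin s) R)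
    (hM : ∀ i j : Fin s, M i j =
      if (j : ℕ) = s - 1 then a i * x i
      else if i = j then -x j
      else if (i : ℕ) = (j : ℕ) + 1 then x i
      else 0) :
    M.det = (-1) ^ (s - 1) * (∑ i, a i) * ∏ i, x i := by
  obtain ⟨n, rfl⟩ : ∃ n, s = n + 1 := ⟨s - 1, by omega⟩
  have hfac : M = Matrix.diagonal x * Matrix.of fun i : Fin (n + 1) =>
      (Fin.snoc (α := fun _ => R)
        (fun j : Fin n => (if i = j.succ then (1 : R) else 0) - if i = j.castSucc then 1 else 0)
        (a i) : Fin (n + 1) → R) := by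
    ext i j
    rw [hM, Matrix.diagonal_mul, Matrix.of_apply]
    induction j using Fin.lastCases with
    | last => simp [mul_comm]
    | cast j =>
      have hj : (j : ℕ) ≠ n := j.isLt.ne
      simp only [Fin.snoc_castSucc, Fin.val_castSucc, Nat.add_sub_cancel, if_neg hj]
      by_cases hij : i = j.castSucc
      · subst hij
        simp [Fin.ext_iff]
      · simp [hij, Fin.ext_iff]
  rw [hfac, Matrix.det_mul, Matrix.det_diagonal, Matrix.det_snoc_single_succ_sub_castSucc,
    Nat.add_sub_cancel, mul_comm]
end

section
/- Let n ≥ 1, let S = ℂ[x_1,…,x_n], let f ∈ S be nonzero and squarefree, and let θ_1,…,θ_n ∈ D(f). Then f divides the determinant of the n×n matrix over S whose (i,j) entry is the i-th coordinate of θ_j. (This divisibility, for any n-tuple of logarithmic derivations of a reduced divisor, underlies both directions of the Saito criterion, Theorem 4.2 of the paper.) -/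
open MvPolynomial

theorem Squarefree.dvd_of_forall_prime_dvd_s12 {R : Type*} [CommMonoidWithZero R]
    [UniqueFactorizationMonoid R] {f d : R} (hf0 : f ≠ 0) (hsq : Squarefree f)
    (h : ∀ p, Prime p → p ∣ f → p ∣ d) : f ∣ d := by
  induction f using UniqueFactorizationMonoid.induction_on_prime with
  | h₁ => exact absurd rfl hf0
  | h₂ x hx => exact hx.dvd
  | h₃ a p ha hp ih =>
    obtain ⟨e, rfl⟩ := ih ha hsq.of_mul_right fun q hq hqa => h q hq (hqa.mul_left p)
    have hpa : ¬ p ∣ a := fun hpa => hp.not_isUnit (hsq p (mul_dvd_mul_left p hpa))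
    rw [mul_comm p a]
    exact mul_dvd_mul_left a ((hp.dvd_or_dvd (h p hp (dvd_mul_right p a))).resolve_left hpa)

namespace MvPolynomial

theorem totalDegree_pderiv_lt {R σ : Type*} [CommSemiring R] {p : MvPolynomial σ R} {i : σ}
    (h : pderiv i p ≠ 0) : (pderiv i p).totalDegree < p.totalDegree := by
  have key : ∀ m ∈ (pderiv i p).support, (m.sum fun _ e => e) < p.totalDegree := by
    intro m hm
    rw [mem_support_iff, coeff_pderiv] at hm
    have hle := le_totalDegree (mem_support_iff.mpr (left_ne_zero_of_mul hm))
    rw [Finsupp.sum_add_index' (fun _ => rfl) (fun _ _ _ => rfl),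
      Finsupp.sum_single_index rfl] at hle
    omega
  obtain ⟨m, hm⟩ := support_nonempty.mpr h
  exact (Finset.sup_lt_iff ((Nat.zero_le _).trans_lt (key m hm))).mpr key

theorem pderiv_eq_zero_of_dvd_s12 {R σ : Type*} [CommRing R] [IsDomain R] {p : MvPolynomial σ R}
    {i : σ} (h : p ∣ pderiv i p) : pderiv i p = 0 := by
  by_contra h0
  exact (totalDegree_le_of_dvd_of_isDomain h h0).not_gt (totalDegree_pderiv_lt h0)

theorem eq_C_of_forall_pderiv_eq_zero_s12 {R σ : Type*} [CommRing R] [IsDomain R] [CharZero R]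
    {p : MvPolynomial σ R} (h : ∀ i, pderiv i p = 0) : p = C (coeff 0 p) := by
  classical
  ext m
  rw [coeff_C]
  split_ifs with hm
  · rw [← hm]
  · obtain ⟨i, hi⟩ := Finsupp.ne_iff.mp (Ne.symm hm)
    have hle : Finsupp.single i 1 ≤ m := by
      simpa [Finsupp.single_le_iff, Nat.one_le_iff_ne_zero] using hi
    have hc := congrArg (coeff (m - Finsupp.single i 1)) (h i)
    rw [coeff_pderiv, coeff_zero, tsub_add_cancel_of_le hle] at hc
    exact (mul_eq_zero.mp hc).resolve_right (Nat.cast_add_one_ne_zero _)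

theorem exists_not_dvd_pderiv_s12 {k σ : Type*} [Field k] [CharZero k] {p : MvPolynomial σ k}
    (hp : Prime p) : ∃ i, ¬ p ∣ pderiv i p := by
  by_contra! h
  have hC := eq_C_of_forall_pderiv_eq_zero_s12 fun i => pderiv_eq_zero_of_dvd_s12 (h i)
  refine hp.not_isUnit ?_
  rw [hC]
  refine (IsUnit.mk0 _ fun h0 => hp.ne_zero ?_).map C
  rw [hC, h0, C_0]

end MvPolynomial

theorem Dlog_le_of_prime_dvd {n : ℕ} {f p : MvPolynomial (Fin n) ℂ} (hsq : Squarefree f)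
    (hp : Prime p) (hpf : p ∣ f) : Dlog f ≤ Dlog p := by
  intro μ hμ
  obtain ⟨g, rfl⟩ := hpf
  have hpg : ¬ p ∣ g := fun hpg => hp.not_isUnit (hsq p (mul_dvd_mul_left p hpg))
  have h : p ∣ ∑ i, μ i * pderiv i (p * g) := (dvd_mul_right p g).trans hμ
  have hsum : ∑ i, μ i * pderiv i (p * g) =
      (∑ i, μ i * pderiv i p) * g + p * ∑ i, μ i * pderiv i g := by
    rw [Finset.sum_mul, Finset.mul_sum, ← Finset.sum_add_distrib]
    exact Finset.sum_congr rfl fun i _ => by rw [pderiv_mul]; ring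
  rw [hsum, dvd_add_left (dvd_mul_right p _)] at h
  exact (hp.dvd_or_dvd h).resolve_right hpg

open scoped Matrix in
theorem Matrix.dvd_det_mul_of_dvd_vecMul {R m : Type*} [CommRing R] [Fintype m] [DecidableEq m]
    {A : Matrix m m R} {v : m → R} {p : R} (h : ∀ j, p ∣ (v ᵥ* A) j) (i : m) :
    p ∣ A.det * v i := by
  have hv : (v ᵥ* A) ᵥ* A.adjugate = A.det • v := by
    rw [Matrix.vecMul_vecMul, Matrix.mul_adjugate, Matrix.vecMul_smul, Matrix.vecMul_one]
  rw [← smul_eq_mul, ← Pi.smul_apply, ← hv]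
  exact Finset.dvd_sum fun j _ => (h j).mul_right _

/-- The divisibility underlying both directions of the Saito criterion (Theorem 4.2 of the
paper): for a nonzero squarefree `f ∈ ℂ[x_1,…,x_n]` and logarithmic derivations
`θ_1,…,θ_n ∈ D(f)`, `f` divides the determinant of the coefficient matrix of the `θ_j`. -/
theorem dvd_det_of_logarithmic (n : ℕ) (hn : 1 ≤ n)
    (f : MvPolynomial (Fin n) ℂ) (hf0 : f ≠ 0) (hsq : Squarefree f)
    (θ : Fin n → Fin n → MvPolynomial (Fin n) ℂ)
    (hθ : ∀ j, θ j ∈ Dlog f) :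
    f ∣ (Matrix.of fun i j => θ j i).det := by
  refine hsq.dvd_of_forall_prime_dvd_s12 hf0 fun p hp hpf => ?_
  obtain ⟨i, hi⟩ := exists_not_dvd_pderiv_s12 hp
  refine (hp.dvd_or_dvd (Matrix.dvd_det_mul_of_dvd_vecMul (v := fun i => pderiv i p)
    (fun j => ?_) i)).resolve_right hi
  have h : p ∣ ∑ i, θ j i * pderiv i p := Dlog_le_of_prime_dvd hsq hp hpf (hθ j)
  simpa [Matrix.vecMul, dotProduct, mul_comm] using h
end
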